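/- arXiv:1909.03830 — 4 statements merged into one kernel-verified Lean document; each statement's English description precedes it below -/
import Mathlib

section
/- For any 0 < ε ≤ 1, the set S(r_1, r_2, r_3) = {𝒯 ∈ ℝ^{p_1×p_2×p_3} : ‖𝒯‖_F = 1, rank(𝒯_(i)) ≤ r_i for i = 1,2,3} admits an ε-net in the Frobenius norm, i.e., a finite set S̄ of tensors such that every 𝒯 ∈ S satisfies ‖𝒯 − 𝒯̄‖_F ≤ ε for some 𝒯̄ ∈ S̄, of cardinality at most (12/ε)^{r_1 r_2 r_3 + p_1 r_1 + p_2 r_2 + p_3 r_3}. -/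
noncomputable section
open Matrix BigOperators Kronecker

namespace TAR

/-- Frobenius norm of a third-order tensor. -/
def frobT {p1 p2 p3 : ℕ} (T : Fin p1 → Fin p2 → Fin p3 → ℝ) : ℝ :=
  Real.sqrt (∑ i, ∑ j, ∑ k, (T i j k) ^ 2)

/-- Mode-1 unfolding of a third-order tensor (columns are mode-1 fibers). -/
def unfold1 {p1 p2 p3 : ℕ} (T : Fin p1 → Fin p2 → Fin p3 → ℝ) :
    Matrix (Fin p1) (Fin p3 × Fin p2) ℝ := Matrix.of fun i q => T i q.2 q.1

/-- Mode-2 unfolding. -/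
def unfold2 {p1 p2 p3 : ℕ} (T : Fin p1 → Fin p2 → Fin p3 → ℝ) :
    Matrix (Fin p2) (Fin p3 × Fin p1) ℝ := Matrix.of fun j q => T q.2 j q.1

/-- Mode-3 unfolding. -/
def unfold3 {p1 p2 p3 : ℕ} (T : Fin p1 → Fin p2 → Fin p3 → ℝ) :
    Matrix (Fin p3) (Fin p2 × Fin p1) ℝ := Matrix.of fun k q => T q.2 q.1 k

end TAR

namespace TARProof

open Module MeasureTheory Metric TAR
open scoped ENNReal Matrix.Norms.L2Operator

open scoped Function in
theorem card_le_of_sep {E : Type*} [NormedAddCommGroup E] [NormedSpace ℝ E]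
    [FiniteDimensional ℝ E] (δ : ℝ) (hδ : 0 < δ) (s : Finset E) (hs : ∀ c ∈ s, ‖c‖ ≤ 1)
    (h : ∀ c ∈ s, ∀ d ∈ s, c ≠ d → δ ≤ ‖c - d‖) :
    (s.card : ℝ) ≤ (1 + 2 / δ) ^ finrank ℝ E := by
  borelize E
  let μ : Measure E := Measure.addHaar
  let ρ : ℝ := 1 + δ / 2
  have ρpos : 0 < ρ := by positivity
  set A := ⋃ c ∈ s, ball (c : E) (δ / 2) with hA
  have D : Set.Pairwise (s : Set E) (Disjoint on fun c => ball (c : E) (δ / 2)) := by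
    rintro c hc d hd hcd
    apply ball_disjoint_ball
    rw [dist_eq_norm]
    have := h c hc d hd hcd
    linarith
  have A_subset : A ⊆ ball (0 : E) ρ := by
    refine Set.iUnion₂_subset fun x hx => ?_
    apply ball_subset_ball'
    rw [dist_zero_right]
    have := hs x hx
    simp only [ρ]
    linarith
  have I :
    (s.card : ℝ≥0∞) * ENNReal.ofReal ((δ / 2) ^ finrank ℝ E) * μ (ball 0 1) ≤
      ENNReal.ofReal (ρ ^ finrank ℝ E) * μ (ball 0 1) :=
    calc
      (s.card : ℝ≥0∞) * ENNReal.ofReal ((δ / 2) ^ finrank ℝ E) * μ (ball 0 1) = μ A := by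
        rw [hA, measure_biUnion_finset D fun c _ => measurableSet_ball]
        have I : 0 < δ / 2 := by positivity
        simp only [μ.addHaar_ball_of_pos _ I]
        simp only [Finset.sum_const, nsmul_eq_mul, mul_assoc]
      _ ≤ μ (ball (0 : E) ρ) := measure_mono A_subset
      _ = ENNReal.ofReal (ρ ^ finrank ℝ E) * μ (ball 0 1) := by
        simp only [μ.addHaar_ball_of_pos _ ρpos]
  have J : (s.card : ℝ≥0∞) * ENNReal.ofReal ((δ / 2) ^ finrank ℝ E) ≤
      ENNReal.ofReal (ρ ^ finrank ℝ E) :=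
    (ENNReal.mul_le_mul_iff_left (measure_ball_pos _ _ zero_lt_one).ne' measure_ball_lt_top.ne).1 I
  have K := ENNReal.toReal_le_of_le_ofReal (pow_nonneg ρpos.le _) J
  rw [ENNReal.toReal_mul, ENNReal.toReal_natCast,
    ENNReal.toReal_ofReal (by positivity)] at K
  have e : (1 + 2 / δ) = ρ / (δ / 2) := by
    simp only [ρ]; field_simp; ring
  rw [e, div_pow, le_div_iff₀ (by positivity)]
  exact K

theorem exists_net (E : Type*) [NormedAddCommGroup E] [NormedSpace ℝ E]
    [FiniteDimensional ℝ E] (δ : ℝ) (hδ : 0 < δ) :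
    ∃ s : Finset E, (s.card : ℝ) ≤ (1 + 2 / δ) ^ finrank ℝ E ∧ (∀ c ∈ s, ‖c‖ ≤ 1) ∧
      ∀ x : E, ‖x‖ ≤ 1 → ∃ c ∈ s, ‖x - c‖ ≤ δ := by
  classical
  let P : Set ℕ := {n | ∃ s : Finset E, s.card = n ∧ (∀ c ∈ s, ‖c‖ ≤ 1) ∧
    (∀ c ∈ s, ∀ d ∈ s, c ≠ d → δ ≤ ‖c - d‖)}
  have hne : P.Nonempty := ⟨0, ∅, by simp⟩
  have hbd : BddAbove P := by
    refine ⟨⌊(1 + 2 / δ) ^ finrank ℝ E⌋₊, ?_⟩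
    rintro n ⟨s, rfl, h1, h2⟩
    exact Nat.le_floor (card_le_of_sep δ hδ s h1 h2)
  obtain ⟨s, hc, h1, h2⟩ := Nat.sSup_mem hne hbd
  refine ⟨s, card_le_of_sep δ hδ s h1 h2, h1, fun x hx => ?_⟩
  by_contra! hcon
  have hxs : x ∉ s := fun hm => by
    have := hcon x hm
    simp at this
    linarith
  have : s.card + 1 ∈ P := by
    refine ⟨insert x s, Finset.card_insert_of_notMem hxs, ?_, ?_⟩
    · intro c hc
      rcases Finset.mem_insert.1 hc with rfl | hc
      · exact hx
      · exact h1 c hc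
    · intro c hc d hd hcd
      rcases Finset.mem_insert.1 hc with hc | hc <;> rcases Finset.mem_insert.1 hd with hd | hd
      · exact absurd (hc.trans hd.symm) hcd
      · rw [hc]; exact (hcon d hd).le
      · rw [hd, norm_sub_rev]; exact (hcon c hc).le
      · exact h2 c hc d hd hcd
  have := le_csSup hbd this
  omega

/-- Three-way array. -/
abbrev Ten (a b c : ℕ) := Fin a → Fin b → Fin c → ℝ

/-- Flattening of a tensor to a Euclidean vector. -/
def flat {a b c : ℕ} (T : Ten a b c) : EuclideanSpace ℝ (Fin a × Fin b × Fin c) :=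
  WithLp.toLp 2 fun x => T x.1 x.2.1 x.2.2

theorem frobT_eq {a b c : ℕ} (T : Ten a b c) : frobT T = ‖flat T‖ := by
  simp [frobT, flat, EuclideanSpace.norm_eq, Fintype.sum_prod_type]

theorem frobT_add_le {a b c : ℕ} (S T : Ten a b c) : frobT (S + T) ≤ frobT S + frobT T := by
  simp only [frobT_eq]
  exact norm_add_le (flat S) (flat T)

theorem frobT_sq {a b c : ℕ} (T : Ten a b c) : frobT T ^ 2 = ∑ i, ∑ j, ∑ k, (T i j k) ^ 2 :=
  Real.sq_sqrt (by positivity)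

theorem frobT_nonneg {a b c : ℕ} (T : Ten a b c) : 0 ≤ frobT T := Real.sqrt_nonneg _

/-- Mode products. -/
def m1 {p a b c : ℕ} (U : Matrix (Fin p) (Fin a) ℝ) (T : Ten a b c) : Ten p b c :=
  fun i j k => ∑ x, U i x * T x j k

def m2 {p a b c : ℕ} (U : Matrix (Fin p) (Fin b) ℝ) (T : Ten a b c) : Ten a p c :=
  fun i j k => ∑ x, U j x * T i x k

def m3 {p a b c : ℕ} (U : Matrix (Fin p) (Fin c) ℝ) (T : Ten a b c) : Ten a b p :=
  fun i j k => ∑ x, U k x * T i j x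

theorem le_of_sq_le {x y : ℝ} (hy : 0 ≤ y) (h : x ^ 2 ≤ y ^ 2) : x ≤ y :=
  le_of_abs_le (abs_le_of_sq_le_sq h hy)

theorem vec_bound {p a : ℕ} (U : Matrix (Fin p) (Fin a) ℝ) (v : Fin a → ℝ) :
    ∑ i, (∑ x, U i x * v x) ^ 2 ≤ ‖U‖ ^ 2 * ∑ x, v x ^ 2 := by
  have h := Matrix.l2_opNorm_mulVec U (WithLp.toLp 2 v)
  have h2 := pow_le_pow_left₀ (norm_nonneg _) h 2
  rw [mul_pow, EuclideanSpace.norm_sq_eq, EuclideanSpace.norm_sq_eq] at h2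
  simpa [Matrix.mulVec, dotProduct] using h2

theorem frobT_m1 {p a b c : ℕ} (U : Matrix (Fin p) (Fin a) ℝ) (T : Ten a b c) :
    frobT (m1 U T) ≤ ‖U‖ * frobT T := by
  refine le_of_sq_le (mul_nonneg (norm_nonneg _) (frobT_nonneg _)) ?_
  rw [mul_pow, frobT_sq, frobT_sq]
  calc ∑ i, ∑ j, ∑ k, (m1 U T i j k) ^ 2 = ∑ j, ∑ k, ∑ i, (∑ x, U i x * T x j k) ^ 2 := by
        rw [Finset.sum_comm]; exact Finset.sum_congr rfl fun j _ => Finset.sum_comm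
    _ ≤ ∑ j, ∑ k, ‖U‖ ^ 2 * ∑ x, T x j k ^ 2 :=
        Finset.sum_le_sum fun j _ => Finset.sum_le_sum fun k _ => vec_bound U fun x => T x j k
    _ = ‖U‖ ^ 2 * ∑ j, ∑ k, ∑ x, T x j k ^ 2 := by simp only [Finset.mul_sum]
    _ = _ := by
        congr 1; symm
        rw [Finset.sum_comm]; exact Finset.sum_congr rfl fun j _ => Finset.sum_comm

theorem frobT_m2 {p a b c : ℕ} (U : Matrix (Fin p) (Fin b) ℝ) (T : Ten a b c) :
    frobT (m2 U T) ≤ ‖U‖ * frobT T := by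
  refine le_of_sq_le (mul_nonneg (norm_nonneg _) (frobT_nonneg _)) ?_
  rw [mul_pow, frobT_sq, frobT_sq]
  calc ∑ i, ∑ j, ∑ k, (m2 U T i j k) ^ 2 = ∑ i, ∑ k, ∑ j, (∑ x, U j x * T i x k) ^ 2 :=
        Finset.sum_congr rfl fun j _ => Finset.sum_comm
    _ ≤ ∑ i, ∑ k, ‖U‖ ^ 2 * ∑ x, T i x k ^ 2 :=
        Finset.sum_le_sum fun i _ => Finset.sum_le_sum fun k _ => vec_bound U fun x => T i x k
    _ = ‖U‖ ^ 2 * ∑ i, ∑ k, ∑ x, T i x k ^ 2 := by simp only [Finset.mul_sum]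
    _ = _ := by
        congr 1
        exact Finset.sum_congr rfl fun j _ => Finset.sum_comm

theorem frobT_m3 {p a b c : ℕ} (U : Matrix (Fin p) (Fin c) ℝ) (T : Ten a b c) :
    frobT (m3 U T) ≤ ‖U‖ * frobT T := by
  refine le_of_sq_le (mul_nonneg (norm_nonneg _) (frobT_nonneg _)) ?_
  rw [mul_pow, frobT_sq, frobT_sq]
  calc ∑ i, ∑ j, ∑ k, (m3 U T i j k) ^ 2
      ≤ ∑ i, ∑ j, ‖U‖ ^ 2 * ∑ x, T i j x ^ 2 :=
        Finset.sum_le_sum fun i _ => Finset.sum_le_sum fun j _ => vec_bound U fun x => T i j x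
    _ = _ := by simp only [Finset.mul_sum]

theorem m1_m2 {p q a b c : ℕ} (U : Matrix (Fin p) (Fin a) ℝ) (V : Matrix (Fin q) (Fin b) ℝ)
    (T : Ten a b c) : m1 U (m2 V T) = m2 V (m1 U T) := by
  funext i j k
  simp only [m1, m2, Finset.mul_sum]
  rw [Finset.sum_comm]
  exact Finset.sum_congr rfl fun _ _ => Finset.sum_congr rfl fun _ _ => by ring

theorem m1_m3 {p q a b c : ℕ} (U : Matrix (Fin p) (Fin a) ℝ) (V : Matrix (Fin q) (Fin c) ℝ)
    (T : Ten a b c) : m1 U (m3 V T) = m3 V (m1 U T) := by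
  funext i j k
  simp only [m1, m3, Finset.mul_sum]
  rw [Finset.sum_comm]
  exact Finset.sum_congr rfl fun _ _ => Finset.sum_congr rfl fun _ _ => by ring

theorem m2_m3 {p q a b c : ℕ} (U : Matrix (Fin p) (Fin b) ℝ) (V : Matrix (Fin q) (Fin c) ℝ)
    (T : Ten a b c) : m2 U (m3 V T) = m3 V (m2 U T) := by
  funext i j k
  simp only [m2, m3, Finset.mul_sum]
  rw [Finset.sum_comm]
  exact Finset.sum_congr rfl fun _ _ => Finset.sum_congr rfl fun _ _ => by ring

theorem m1_sub {p a b c : ℕ} (U V : Matrix (Fin p) (Fin a) ℝ) (T : Ten a b c) :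
    m1 (U - V) T = m1 U T - m1 V T := by
  funext i j k; simp [m1, sub_mul]
theorem m2_sub {p a b c : ℕ} (U V : Matrix (Fin p) (Fin b) ℝ) (T : Ten a b c) :
    m2 (U - V) T = m2 U T - m2 V T := by
  funext i j k; simp [m2, sub_mul]
theorem m3_sub {p a b c : ℕ} (U V : Matrix (Fin p) (Fin c) ℝ) (T : Ten a b c) :
    m3 (U - V) T = m3 U T - m3 V T := by
  funext i j k; simp [m3, sub_mul]
theorem m1_sub' {p a b c : ℕ} (U : Matrix (Fin p) (Fin a) ℝ) (S T : Ten a b c) :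
    m1 U (S - T) = m1 U S - m1 U T := by
  funext i j k; simp [m1, mul_sub]
theorem m2_sub' {p a b c : ℕ} (U : Matrix (Fin p) (Fin b) ℝ) (S T : Ten a b c) :
    m2 U (S - T) = m2 U S - m2 U T := by
  funext i j k; simp [m2, mul_sub]
theorem m3_sub' {p a b c : ℕ} (U : Matrix (Fin p) (Fin c) ℝ) (S T : Ten a b c) :
    m3 U (S - T) = m3 U S - m3 U T := by
  funext i j k; simp [m3, mul_sub]

theorem exists_factor {p r : ℕ} {n : Type*} [Fintype n] [DecidableEq n]
    (A : Matrix (Fin p) n ℝ) (h : A.rank ≤ r) :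
    ∃ (U : Matrix (Fin p) (Fin r) ℝ) (V : Matrix (Fin r) (Fin p) ℝ), ‖U‖ ≤ 1 ∧ ‖V‖ ≤ 1 ∧
      U * (V * A) = A := by
  let C : Submodule ℝ (EuclideanSpace ℝ (Fin p)) := LinearMap.range (Matrix.toEuclideanLin A)
  have hC : finrank ℝ C ≤ finrank ℝ (EuclideanSpace ℝ (Fin r)) := by
    rw [finrank_euclideanSpace_fin]
    rw [Matrix.rank_eq_finrank_range_toLin A (EuclideanSpace.basisFun _ ℝ).toBasis
      (EuclideanSpace.basisFun _ ℝ).toBasis] at h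
    exact h
  obtain ⟨f, hf⟩ := (finrank_le_iff_exists_linearMap).1 hC
  let D := LinearMap.range f
  have hd : finrank ℝ C = finrank ℝ D := (LinearMap.finrank_range_of_inj hf).symm
  let e : C ≃ₗᵢ[ℝ] D :=
    (stdOrthonormalBasis ℝ C).equiv (stdOrthonormalBasis ℝ D) (finCongr hd)
  let u : EuclideanSpace ℝ (Fin r) →ₗ[ℝ] EuclideanSpace ℝ (Fin p) :=
    C.subtype ∘ₗ e.symm.toLinearEquiv.toLinearMap ∘ₗ D.orthogonalProjectionOnto.toLinearMap
  let v : EuclideanSpace ℝ (Fin p) →ₗ[ℝ] EuclideanSpace ℝ (Fin r) :=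
    D.subtype ∘ₗ e.toLinearEquiv.toLinearMap ∘ₗ C.orthogonalProjectionOnto.toLinearMap
  have hu : ∀ x, ‖u x‖ ≤ 1 * ‖x‖ := fun x => by
    rw [one_mul]
    calc ‖u x‖ = ‖e.symm (D.orthogonalProjectionOnto x)‖ := rfl
      _ = ‖D.orthogonalProjectionOnto x‖ := e.symm.norm_map _
      _ ≤ 1 * ‖x‖ := (D.orthogonalProjectionOnto.le_opNorm x).trans
        (mul_le_mul_of_nonneg_right (D.orthogonalProjectionOnto_norm_le) (norm_nonneg _))
      _ = ‖x‖ := one_mul _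
  have hv : ∀ x, ‖v x‖ ≤ 1 * ‖x‖ := fun x => by
    rw [one_mul]
    calc ‖v x‖ = ‖e (C.orthogonalProjectionOnto x)‖ := rfl
      _ = ‖C.orthogonalProjectionOnto x‖ := e.norm_map _
      _ ≤ 1 * ‖x‖ := (C.orthogonalProjectionOnto.le_opNorm x).trans
        (mul_le_mul_of_nonneg_right (C.orthogonalProjectionOnto_norm_le) (norm_nonneg _))
      _ = ‖x‖ := one_mul _
  have huv : ∀ x ∈ C, u (v x) = x := fun x hx => by
    have h1 : C.orthogonalProjectionOnto x = ⟨x, hx⟩ :=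
      Submodule.orthogonalProjectionOnto_mem_subspace_eq_self (⟨x, hx⟩ : C)
    have h2 : D.orthogonalProjectionOnto (v x) = e ⟨x, hx⟩ := by
      have : v x = ((e ⟨x, hx⟩ : D) : EuclideanSpace ℝ (Fin r)) := by
        rw [← h1]; rfl
      rw [this]
      exact Submodule.orthogonalProjectionOnto_mem_subspace_eq_self _
    change ((e.symm (D.orthogonalProjectionOnto (v x)) : C) : EuclideanSpace ℝ (Fin p)) = x
    rw [h2, e.symm_apply_apply]
  refine ⟨Matrix.toEuclideanLin.symm u, Matrix.toEuclideanLin.symm v, ?_, ?_, ?_⟩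
  · rw [Matrix.l2_opNorm_def, LinearEquiv.trans_apply, LinearEquiv.apply_symm_apply]
    exact ContinuousLinearMap.opNorm_le_bound _ zero_le_one hu
  · rw [Matrix.l2_opNorm_def, LinearEquiv.trans_apply, LinearEquiv.apply_symm_apply]
    exact ContinuousLinearMap.opNorm_le_bound _ zero_le_one hv
  · apply Matrix.toEuclideanLin.injective
    rw [Matrix.toEuclideanLin_eq_toLin_orthonormal,
      Matrix.toLin_mul _ (EuclideanSpace.basisFun _ ℝ).toBasis,
      Matrix.toLin_mul _ (EuclideanSpace.basisFun _ ℝ).toBasis]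
    rw [← Matrix.toEuclideanLin_eq_toLin_orthonormal, ← Matrix.toEuclideanLin_eq_toLin_orthonormal,
      ← Matrix.toEuclideanLin_eq_toLin_orthonormal, LinearEquiv.apply_symm_apply,
      LinearEquiv.apply_symm_apply]
    refine LinearMap.ext fun x => ?_
    exact huv _ (LinearMap.mem_range_self _ x)

theorem m1_cancel {p r b c : ℕ} (T : Ten p b c) (h : (unfold1 T).rank ≤ r) :
    ∃ (U : Matrix (Fin p) (Fin r) ℝ) (V : Matrix (Fin r) (Fin p) ℝ), ‖U‖ ≤ 1 ∧ ‖V‖ ≤ 1 ∧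
      m1 U (m1 V T) = T := by
  obtain ⟨U, V, hU, hV, hA⟩ := exists_factor _ h
  refine ⟨U, V, hU, hV, ?_⟩
  funext i j k
  exact congrFun (congrFun hA i) (k, j)

theorem m2_cancel {p r b c : ℕ} (T : Ten b p c) (h : (unfold2 T).rank ≤ r) :
    ∃ (U : Matrix (Fin p) (Fin r) ℝ) (V : Matrix (Fin r) (Fin p) ℝ), ‖U‖ ≤ 1 ∧ ‖V‖ ≤ 1 ∧
      m2 U (m2 V T) = T := by
  obtain ⟨U, V, hU, hV, hA⟩ := exists_factor _ h
  refine ⟨U, V, hU, hV, ?_⟩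
  funext i j k
  exact congrFun (congrFun hA j) (k, i)

theorem m3_cancel {p r b c : ℕ} (T : Ten b c p) (h : (unfold3 T).rank ≤ r) :
    ∃ (U : Matrix (Fin p) (Fin r) ℝ) (V : Matrix (Fin r) (Fin p) ℝ), ‖U‖ ≤ 1 ∧ ‖V‖ ≤ 1 ∧
      m3 U (m3 V T) = T := by
  obtain ⟨U, V, hU, hV, hA⟩ := exists_factor _ h
  refine ⟨U, V, hU, hV, ?_⟩
  funext i j k
  exact congrFun (congrFun hA k) (j, i)

theorem contract1 {p a b c : ℕ} {U : Matrix (Fin p) (Fin a) ℝ} {T : Ten a b c} {x y : ℝ}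
    (hU : ‖U‖ ≤ x) (hT : frobT T ≤ y) : frobT (m1 U T) ≤ x * y :=
  (frobT_m1 U T).trans (mul_le_mul hU hT (frobT_nonneg _) ((norm_nonneg _).trans hU))
theorem contract2 {p a b c : ℕ} {U : Matrix (Fin p) (Fin b) ℝ} {T : Ten a b c} {x y : ℝ}
    (hU : ‖U‖ ≤ x) (hT : frobT T ≤ y) : frobT (m2 U T) ≤ x * y :=
  (frobT_m2 U T).trans (mul_le_mul hU hT (frobT_nonneg _) ((norm_nonneg _).trans hU))
theorem contract3 {p a b c : ℕ} {U : Matrix (Fin p) (Fin c) ℝ} {T : Ten a b c} {x y : ℝ}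
    (hU : ‖U‖ ≤ x) (hT : frobT T ≤ y) : frobT (m3 U T) ≤ x * y :=
  (frobT_m3 U T).trans (mul_le_mul hU hT (frobT_nonneg _) ((norm_nonneg _).trans hU))

theorem telescope {p1 p2 p3 r1 r2 r3 : ℕ} {δ : ℝ}
    {U1 U1' : Matrix (Fin p1) (Fin r1) ℝ} {U2 U2' : Matrix (Fin p2) (Fin r2) ℝ}
    {U3 U3' : Matrix (Fin p3) (Fin r3) ℝ} {G G' : Ten r1 r2 r3}
    (h1' : ‖U1'‖ ≤ 1) (h2 : ‖U2‖ ≤ 1) (h2' : ‖U2'‖ ≤ 1) (h3 : ‖U3‖ ≤ 1)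
    (h3' : ‖U3'‖ ≤ 1) (hG : frobT G ≤ 1)
    (d1 : ‖U1 - U1'‖ ≤ δ) (d2 : ‖U2 - U2'‖ ≤ δ) (d3 : ‖U3 - U3'‖ ≤ δ) (dG : frobT (G - G') ≤ δ) :
    frobT (m1 U1 (m2 U2 (m3 U3 G)) - m1 U1' (m2 U2' (m3 U3' G'))) ≤ 4 * δ := by
  have e : m1 U1 (m2 U2 (m3 U3 G)) - m1 U1' (m2 U2' (m3 U3' G')) =
      m1 (U1 - U1') (m2 U2 (m3 U3 G)) + (m1 U1' (m2 (U2 - U2') (m3 U3 G)) +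
      (m1 U1' (m2 U2' (m3 (U3 - U3') G)) + m1 U1' (m2 U2' (m3 U3' (G - G'))))) := by
    simp only [m1_sub, m2_sub, m3_sub, m1_sub', m2_sub', m3_sub']
    abel
  rw [e]
  have a1 := contract1 d1 (contract2 h2 (contract3 h3 hG))
  have a2 := contract1 h1' (contract2 d2 (contract3 h3 hG))
  have a3 := contract1 h1' (contract2 h2' (contract3 d3 hG))
  have a4 := contract1 h1' (contract2 h2' (contract3 h3' dG))
  refine (frobT_add_le _ _).trans ?_
  have b1 := frobT_add_le (m1 U1' (m2 (U2 - U2') (m3 U3 G)))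
    (m1 U1' (m2 U2' (m3 (U3 - U3') G)) + m1 U1' (m2 U2' (m3 U3' (G - G'))))
  have b2 := frobT_add_le (m1 U1' (m2 U2' (m3 (U3 - U3') G))) (m1 U1' (m2 U2' (m3 U3' (G - G'))))
  linarith

/-- Inverse of `flat`. -/
def unflat {a b c : ℕ} (x : EuclideanSpace ℝ (Fin a × Fin b × Fin c)) : Ten a b c :=
  fun i j k => x (i, j, k)

end TARProof

open TAR in
/-- Lemma 1 of the paper: covering number of unit-Frobenius-norm tensors with
Tucker ranks at most (r1, r2, r3). -/
theorem statement5 (p1 p2 p3 r1 r2 r3 : ℕ) (ε : ℝ) (hε : 0 < ε) (hε1 : ε ≤ 1) :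
    ∃ Sbar : Finset (Fin p1 → Fin p2 → Fin p3 → ℝ),
      (Sbar.card : ℝ) ≤ (12 / ε) ^ (r1 * r2 * r3 + p1 * r1 + p2 * r2 + p3 * r3) ∧
      ∀ T : Fin p1 → Fin p2 → Fin p3 → ℝ,
        frobT T = 1 → (unfold1 T).rank ≤ r1 → (unfold2 T).rank ≤ r2 →
        (unfold3 T).rank ≤ r3 →
        ∃ Tb ∈ Sbar, frobT (fun i j k => T i j k - Tb i j k) ≤ ε := by
  classical
  open TARProof in
  open scoped Matrix.Norms.L2Operator in
  have hδ : 0 < ε / 4 := by positivity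
  obtain ⟨N1, c1, b1, n1⟩ := exists_net (Matrix (Fin p1) (Fin r1) ℝ) (ε / 4) hδ
  obtain ⟨N2, c2, b2, n2⟩ := exists_net (Matrix (Fin p2) (Fin r2) ℝ) (ε / 4) hδ
  obtain ⟨N3, c3, b3, n3⟩ := exists_net (Matrix (Fin p3) (Fin r3) ℝ) (ε / 4) hδ
  obtain ⟨N, c, b, n⟩ := exists_net (EuclideanSpace ℝ (Fin r1 × Fin r2 × Fin r3)) (ε / 4) hδ
  have hb : 1 + 2 / (ε / 4) ≤ 12 / ε := by
    have : 1 + 2 / (ε / 4) = (ε + 8) / ε := by field_simp; norm_num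
    rw [this]
    gcongr
    linarith
  refine ⟨(N ×ˢ N1 ×ˢ N2 ×ˢ N3).image fun x =>
    m1 x.2.1 (m2 x.2.2.1 (m3 x.2.2.2 (unflat x.1))), ?_, ?_⟩
  · rw [finrank_euclideanSpace] at c
    rw [Module.finrank_matrix] at c1 c2 c3
    simp only [Fintype.card_prod, Fintype.card_fin, Module.finrank_self, mul_one] at c c1 c2 c3
    calc _ ≤ (((N ×ˢ N1 ×ˢ N2 ×ˢ N3).card : ℕ) : ℝ) := by exact_mod_cast Finset.card_image_le
      _ = N.card * (N1.card * (N2.card * N3.card)) := by simp [Finset.card_product]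
      _ ≤ (12 / ε) ^ (r1 * (r2 * r3)) * ((12 / ε) ^ (p1 * r1) *
          ((12 / ε) ^ (p2 * r2) * (12 / ε) ^ (p3 * r3))) := by
        have h0 : 0 ≤ 1 + 2 / (ε / 4) := by positivity
        have q (k : ℕ) := pow_le_pow_left₀ h0 hb k
        have d := c.trans (q _)
        have d1 := c1.trans (q _)
        have d2 := c2.trans (q _)
        have d3 := c3.trans (q _)
        gcongr
      _ = _ := by simp only [pow_add, mul_assoc]
  · intro T hT k1 k2 k3
    obtain ⟨U1, V1, hU1, hV1, e1⟩ := m1_cancel T k1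
    obtain ⟨U2, V2, hU2, hV2, e2⟩ := m2_cancel T k2
    obtain ⟨U3, V3, hU3, hV3, e3⟩ := m3_cancel T k3
    let G := m1 V1 (m2 V2 (m3 V3 T))
    have hG : frobT G ≤ 1 := by
      simpa using contract1 hV1 (contract2 hV2 (contract3 hV3 hT.le))
    have hTG : T = m1 U1 (m2 U2 (m3 U3 G)) := by
      have : m1 U1 (m2 U2 (m3 U3 G)) =
          m1 U1 (m1 V1 (m2 U2 (m2 V2 (m3 U3 (m3 V3 T))))) := by
        simp only [G, m1_m2, m1_m3, m2_m3]
      rw [this, e3, e2, e1]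
    obtain ⟨W1, hW1, dW1⟩ := n1 U1 hU1
    obtain ⟨W2, hW2, dW2⟩ := n2 U2 hU2
    obtain ⟨W3, hW3, dW3⟩ := n3 U3 hU3
    obtain ⟨H, hH, dH⟩ := n (flat G) (by rwa [← frobT_eq])
    refine ⟨_, Finset.mem_image_of_mem _ (a := (H, W1, W2, W3)) (by simp [*]), ?_⟩
    have dG : frobT (G - unflat H) ≤ ε / 4 := by
      rw [frobT_eq]
      exact dH
    have := telescope (b1 _ hW1) hU2 (b2 _ hW2) hU3 (b3 _ hW3) hG dW1 dW2 dW3 dG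
    rw [← hTG] at this
    calc _ ≤ 4 * (ε / 4) := this
      _ = ε := by ring
end
end

section
/- Let 𝒢 ∈ ℝ^{r_1×r_2×r_3} be a tensor whose mode-1 unfolding 𝒢_(1) has pairwise orthogonal rows, let A ∈ ℝ^{p_1×r_1} be any matrix, and let U_2 ∈ ℝ^{p_2×r_2}, U_3 ∈ ℝ^{p_3×r_3} have orthonormal columns. Then ‖𝒢 ×_1 A ×_2 U_2 ×_3 U_3‖_F = ‖𝒢 ×_1 A‖_F ≤ ‖𝒢‖_F · ‖A‖_{1,2}, where ‖A‖_{1,2} is the maximum Euclidean column norm of A. -/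
noncomputable section
open Matrix BigOperators Kronecker

namespace TAR

/-- The Tucker product ⟦G; U1, U2, U3⟧ = G ×₁ U1 ×₂ U2 ×₃ U3. -/
def tucker {p1 p2 p3 r1 r2 r3 : ℕ} (G : Fin r1 → Fin r2 → Fin r3 → ℝ)
    (U1 : Matrix (Fin p1) (Fin r1) ℝ) (U2 : Matrix (Fin p2) (Fin r2) ℝ)
    (U3 : Matrix (Fin p3) (Fin r3) ℝ) : Fin p1 → Fin p2 → Fin p3 → ℝ :=
  fun i j k => ∑ a, ∑ b, ∑ c, G a b c * U1 i a * U2 j b * U3 k c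

/-- The ‖·‖_{1,2} norm of a matrix: maximum Euclidean norm of its columns. -/
def norm12 {n r : ℕ} (X : Matrix (Fin n) (Fin r) ℝ) : ℝ :=
  ⨆ i : Fin r, Real.sqrt (∑ k, (X k i) ^ 2)

/-- A core tensor is all-orthogonal if, for each mode, the rows of its mode-n
unfolding are pairwise orthogonal. -/
def allOrthogonal {r1 r2 r3 : ℕ} (G : Fin r1 → Fin r2 → Fin r3 → ℝ) : Prop :=
  (∀ a a' : Fin r1, a ≠ a' → ∑ q, unfold1 G a q * unfold1 G a' q = 0) ∧
  (∀ b b' : Fin r2, b ≠ b' → ∑ q, unfold2 G b q * unfold2 G b' q = 0) ∧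
  (∀ c c' : Fin r3, c ≠ c' → ∑ q, unfold3 G c q * unfold3 G c' q = 0)

end TAR

namespace TAR
/-- Mode-1 product G ×₁ A of a tensor with a matrix. -/
def mode1Prod {p1 r1 r2 r3 : ℕ} (G : Fin r1 → Fin r2 → Fin r3 → ℝ)
    (A : Matrix (Fin p1) (Fin r1) ℝ) : Fin p1 → Fin r2 → Fin r3 → ℝ :=
  fun i b c => ∑ a, A i a * G a b c
end TAR

theorem iso_aux {p r : ℕ} (U : Matrix (Fin p) (Fin r) ℝ) (hU : Uᵀ * U = 1) (x : Fin r → ℝ) :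
    ∑ j, (∑ b, U j b * x b) ^ 2 = ∑ b, x b ^ 2 := by
  have h1 : (U *ᵥ x) ⬝ᵥ (U *ᵥ x) = x ⬝ᵥ x := by
    rw [Matrix.dotProduct_mulVec, Matrix.vecMul_mulVec, hU, Matrix.vecMul_one]
  simpa [dotProduct, Matrix.mulVec, sq] using h1

theorem orth_aux {r : ℕ} {κ : Type*} [Fintype κ] (g : Fin r → κ → ℝ)
    (hg : ∀ a a', a ≠ a' → ∑ q, g a q * g a' q = 0) (w : Fin r → ℝ) :
    ∑ q, (∑ a, w a * g a q) ^ 2 = ∑ a, w a ^ 2 * ∑ q, g a q ^ 2 := by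
  have h : ∀ q, (∑ a, w a * g a q) ^ 2 = ∑ a, ∑ a', w a * w a' * (g a q * g a' q) := by
    intro q
    rw [sq, Finset.sum_mul_sum]
    refine Finset.sum_congr rfl fun a _ => Finset.sum_congr rfl fun a' _ => by ring
  simp_rw [h]
  rw [Finset.sum_comm]
  refine Finset.sum_congr rfl fun a _ => ?_
  rw [Finset.sum_comm]
  simp_rw [← Finset.mul_sum]
  rw [Finset.sum_eq_single a]
  · simp [sq]
  · intro a' _ hne
    rw [hg a a' hne.symm, mul_zero]
  · simp

open TAR in
/-- If the rows of G₍₁₎ are pairwise orthogonal, A is arbitrary, and U2, U3 have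
orthonormal columns, then ‖G ×₁ A ×₂ U2 ×₃ U3‖_F = ‖G ×₁ A‖_F ≤ ‖G‖_F ‖A‖_{1,2}. -/
theorem statement10 {p1 p2 p3 r1 r2 r3 : ℕ}
    (G : Fin r1 → Fin r2 → Fin r3 → ℝ) (A : Matrix (Fin p1) (Fin r1) ℝ)
    (U2 : Matrix (Fin p2) (Fin r2) ℝ) (U3 : Matrix (Fin p3) (Fin r3) ℝ)
    (hG : ∀ a a' : Fin r1, a ≠ a' → ∑ q, unfold1 G a q * unfold1 G a' q = 0)
    (hU2 : U2ᵀ * U2 = 1) (hU3 : U3ᵀ * U3 = 1) :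
    frobT (tucker G A U2 U3) = frobT (mode1Prod G A) ∧
    frobT (mode1Prod G A) ≤ frobT G * norm12 A := by
  constructor
  · unfold frobT
    congr 1
    refine Finset.sum_congr rfl fun i _ => ?_
    have h : ∀ j k, tucker G A U2 U3 i j k
        = ∑ b, U2 j b * ∑ c, U3 k c * mode1Prod G A i b c := by
      intro j k
      unfold tucker mode1Prod
      rw [Finset.sum_comm]
      refine Finset.sum_congr rfl fun b _ => ?_
      rw [Finset.sum_comm, Finset.mul_sum]
      refine Finset.sum_congr rfl fun c _ => ?_
      rw [Finset.mul_sum, Finset.mul_sum]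
      refine Finset.sum_congr rfl fun a _ => by ring
    simp_rw [h]
    rw [Finset.sum_comm]
    simp_rw [iso_aux U2 hU2]
    rw [Finset.sum_comm]
    simp_rw [iso_aux U3 hU3]
  · have hn0 : 0 ≤ norm12 A := Real.iSup_nonneg fun i => Real.sqrt_nonneg _
    have hcol : ∀ a, ∑ i, A i a ^ 2 ≤ norm12 A ^ 2 := by
      intro a
      have h1 : Real.sqrt (∑ k, (A k a) ^ 2) ≤ norm12 A :=
        le_ciSup (f := fun a : Fin r1 => Real.sqrt (∑ k, (A k a) ^ 2))
          (Set.finite_range _).bddAbove a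
      exact (Real.sqrt_le_left hn0).1 h1
    have hconv : ∀ {p : ℕ} (T : Fin p → Fin r2 → Fin r3 → ℝ) (i : Fin p),
        ∑ j, ∑ k, T i j k ^ 2 = ∑ q, unfold1 T i q ^ 2 := by
      intro p T i
      rw [Fintype.sum_prod_type, Finset.sum_comm]
      rfl
    have hM : ∀ i, ∑ j, ∑ k, mode1Prod G A i j k ^ 2
        = ∑ a, A i a ^ 2 * ∑ q, unfold1 G a q ^ 2 := by
      intro i
      rw [hconv, ← orth_aux (unfold1 G) hG (A i)]
      rfl
    unfold frobT
    rw [← Real.sqrt_sq hn0, ← Real.sqrt_mul (by positivity)]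
    apply Real.sqrt_le_sqrt
    simp_rw [hM, hconv]
    rw [Finset.sum_comm, Finset.sum_mul]
    refine Finset.sum_le_sum fun a _ => ?_
    rw [← Finset.sum_mul, mul_comm]
    exact mul_le_mul_of_nonneg_left (hcol a) (by positivity)
end
end

section
/- Let Δ ∈ ℝ^{p_1×p_2×p_3} be a tensor whose Tucker ranks satisfy rank_j(Δ) ≤ 4r_j for j = 1,2,3. Then Δ can be written as Δ = Σ_{i=1}^8 Δ_i, where each Δ_i ∈ ℝ^{p_1×p_2×p_3} has Tucker ranks rank_j(Δ_i) ≤ 2r_j for j = 1,2,3, and the summands are pairwise orthogonal: ⟨Δ_j, Δ_k⟩ = 0 for all j ≠ k. -/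
noncomputable section
open Matrix BigOperators Kronecker

namespace TAR
/-- Entrywise inner product of two third-order tensors. -/
def innerT {p1 p2 p3 : ℕ} (A B : Fin p1 → Fin p2 → Fin p3 → ℝ) : ℝ :=
  ∑ i, ∑ j, ∑ k, A i j k * B i j k
end TAR

theorem TAR.exists_U {p : ℕ} {n : Type} [Fintype n] (M : Matrix (Fin p) n ℝ) :
    ∃ U : Matrix (Fin p) (Fin M.rank) ℝ, Uᵀ * U = 1 ∧ U * (Uᵀ * M) = M := by
  classical
  let e := (WithLp.linearEquiv 2 ℝ (Fin p → ℝ)).symm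
  let W : Submodule ℝ (EuclideanSpace ℝ (Fin p)) :=
    (LinearMap.range M.mulVecLin).map (e : (Fin p → ℝ) →ₗ[ℝ] EuclideanSpace ℝ (Fin p))
  have hW : Module.finrank ℝ W = M.rank := LinearEquiv.finrank_map_eq e _
  let b : OrthonormalBasis (Fin M.rank) ℝ W :=
    (stdOrthonormalBasis ℝ W).reindex (finCongr hW)
  refine ⟨Matrix.of fun i l => (b l : EuclideanSpace ℝ (Fin p)) i, ?_, ?_⟩
  · ext l l'
    have h := orthonormal_iff_ite.mp b.orthonormal l l'
    rw [Submodule.coe_inner, PiLp.inner_apply] at h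
    simp only [Matrix.mul_apply, Matrix.transpose_apply, Matrix.of_apply, Matrix.one_apply]
    rw [← h]
    refine Finset.sum_congr rfl fun i _ => ?_
    simp [mul_comm]
  · ext i q
    have hm : e (fun i => M i q) ∈ W := by
      refine Submodule.mem_map_of_mem ⟨Pi.single q 1, ?_⟩
      ext i
      simp
    have h := congrArg (fun w : W => (w : EuclideanSpace ℝ (Fin p)) i)
      (b.sum_repr' ⟨e (fun i => M i q), hm⟩)
    have h2 : (e (fun i => M i q)) i = M i q := rfl
    simp only [h2] at h
    rw [← h]
    simp only [Matrix.mul_apply, Matrix.transpose_apply, Matrix.of_apply,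
      Submodule.coe_sum, Submodule.coe_smul, Submodule.coe_inner, PiLp.inner_apply]
    rw [WithLp.ofLp_sum, Finset.sum_apply]
    refine Finset.sum_congr rfl fun l _ => ?_
    rw [PiLp.smul_apply, smul_eq_mul, mul_comm]
    congr 1
    refine Finset.sum_congr rfl fun i _ => ?_
    have h3 : (e (fun i => M i q)) i = M i q := rfl
    simp [h3, mul_comm]

theorem TAR.exists_split {p r : ℕ} {n : Type} [Fintype n] (M : Matrix (Fin p) n ℝ)
    (h : M.rank ≤ 4 * r) :
    ∃ P : Fin 2 → Matrix (Fin p) (Fin p) ℝ, (P 0 + P 1) * M = M ∧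
      (∀ a, (P a).rank ≤ 2 * r) ∧ ∀ a b, a ≠ b → (P a)ᵀ * P b = 0 := by
  classical
  obtain ⟨U, hU, hM⟩ := TAR.exists_U M
  let w : Fin 2 → Fin M.rank → ℝ := fun a l =>
    if a = 0 then (if l.val < 2 * r then 1 else 0) else (if l.val < 2 * r then 0 else 1)
  have hw : ∀ a b, a ≠ b → Matrix.diagonal (w a) * Matrix.diagonal (w b) = 0 := by
    intro a b hab
    rw [Matrix.diagonal_mul_diagonal, ← Matrix.diagonal_zero]
    congr 1
    funext l
    fin_cases a <;> fin_cases b <;> simp [w] at hab ⊢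
  refine ⟨fun a => U * (Matrix.diagonal (w a) * Uᵀ), ?_, ?_, ?_⟩
  · have h1 : Matrix.diagonal (w 0) + Matrix.diagonal (w 1) = 1 := by
      rw [Matrix.diagonal_add, ← Matrix.diagonal_one]
      congr 1
      funext l
      by_cases hl : l.val < 2 * r <;> simp [w, hl]
    rw [← Matrix.mul_add, ← Matrix.add_mul, h1, Matrix.one_mul, Matrix.mul_assoc, hM]
  · intro a
    refine (Matrix.rank_mul_le_right _ _).trans ((Matrix.rank_mul_le_left _ _).trans ?_)
    rw [Matrix.rank_diagonal]
    rw [← Fintype.card_fin (2 * r)]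
    refine Fintype.card_le_of_injective
      (fun l => if h0 : l.1.val < 2 * r then ⟨l.1.val, h0⟩ else
        ⟨l.1.val - 2 * r, by have := l.1.isLt; omega⟩) ?_
    rintro ⟨l, hl⟩ ⟨l', hl'⟩ hll
    apply Subtype.ext
    apply Fin.ext
    fin_cases a
    · have c : l.val < 2 * r := by by_contra c; simp [w, c] at hl
      have c' : l'.val < 2 * r := by by_contra c; simp [w, c] at hl'
      simpa [c, c'] using hll
    · have c : ¬ l.val < 2 * r := by intro c; simp [w, c] at hl
      have c' : ¬ l'.val < 2 * r := by intro c; simp [w, c] at hl'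
      simp only [c, c', dite_false, Fin.mk.injEq] at hll
      show l.val = l'.val
      omega
  · intro a b hab
    show (U * (Matrix.diagonal (w a) * Uᵀ))ᵀ * (U * (Matrix.diagonal (w b) * Uᵀ)) = 0
    rw [Matrix.transpose_mul, Matrix.transpose_mul, Matrix.transpose_transpose,
      Matrix.diagonal_transpose]
    calc U * diagonal (w a) * Uᵀ * (U * (diagonal (w b) * Uᵀ))
        = U * (diagonal (w a) * (Uᵀ * U) * diagonal (w b)) * Uᵀ := by
          simp only [Matrix.mul_assoc]
      _ = 0 := by rw [hU, Matrix.mul_one, hw a b hab]; simp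

namespace TAR
variable {p1 p2 p3 : ℕ}

def act1 (P : Matrix (Fin p1) (Fin p1) ℝ) (T : Fin p1 → Fin p2 → Fin p3 → ℝ) :
    Fin p1 → Fin p2 → Fin p3 → ℝ := fun i j k => ∑ x, P i x * T x j k

def act2 (P : Matrix (Fin p2) (Fin p2) ℝ) (T : Fin p1 → Fin p2 → Fin p3 → ℝ) :
    Fin p1 → Fin p2 → Fin p3 → ℝ := fun i j k => ∑ x, P j x * T i x k

def act3 (P : Matrix (Fin p3) (Fin p3) ℝ) (T : Fin p1 → Fin p2 → Fin p3 → ℝ) :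
    Fin p1 → Fin p2 → Fin p3 → ℝ := fun i j k => ∑ x, P k x * T i j x

theorem act12 (P : Matrix (Fin p1) (Fin p1) ℝ) (Q : Matrix (Fin p2) (Fin p2) ℝ)
    (T : Fin p1 → Fin p2 → Fin p3 → ℝ) : act1 P (act2 Q T) = act2 Q (act1 P T) := by
  funext i j k
  simp only [act1, act2, Finset.mul_sum]
  rw [Finset.sum_comm]
  simp only [mul_left_comm]

theorem act13 (P : Matrix (Fin p1) (Fin p1) ℝ) (Q : Matrix (Fin p3) (Fin p3) ℝ)
    (T : Fin p1 → Fin p2 → Fin p3 → ℝ) : act1 P (act3 Q T) = act3 Q (act1 P T) := by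
  funext i j k
  simp only [act1, act3, Finset.mul_sum]
  rw [Finset.sum_comm]
  simp only [mul_left_comm]

theorem act23 (P : Matrix (Fin p2) (Fin p2) ℝ) (Q : Matrix (Fin p3) (Fin p3) ℝ)
    (T : Fin p1 → Fin p2 → Fin p3 → ℝ) : act2 P (act3 Q T) = act3 Q (act2 P T) := by
  funext i j k
  simp only [act2, act3, Finset.mul_sum]
  rw [Finset.sum_comm]
  simp only [mul_left_comm]

theorem rank_act1 (P : Matrix (Fin p1) (Fin p1) ℝ) (T : Fin p1 → Fin p2 → Fin p3 → ℝ) :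
    (unfold1 (act1 P T)).rank ≤ P.rank := Matrix.rank_mul_le_left P (unfold1 T)

theorem rank_act2 (P : Matrix (Fin p2) (Fin p2) ℝ) (T : Fin p1 → Fin p2 → Fin p3 → ℝ) :
    (unfold2 (act2 P T)).rank ≤ P.rank := Matrix.rank_mul_le_left P (unfold2 T)

theorem rank_act3 (P : Matrix (Fin p3) (Fin p3) ℝ) (T : Fin p1 → Fin p2 → Fin p3 → ℝ) :
    (unfold3 (act3 P T)).rank ≤ P.rank := Matrix.rank_mul_le_left P (unfold3 T)

theorem vec_orth {p : ℕ} (P Q : Matrix (Fin p) (Fin p) ℝ) (h : Pᵀ * Q = 0)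
    (v w : Fin p → ℝ) : ∑ i, (∑ x, P i x * v x) * (∑ x, Q i x * w x) = 0 := by
  have h1 : (P *ᵥ v) ⬝ᵥ (Q *ᵥ w) = 0 := by
    rw [Matrix.dotProduct_mulVec, ← Matrix.vecMul_transpose, Matrix.vecMul_vecMul, h]
    simp
  exact h1

theorem orth1 (P Q : Matrix (Fin p1) (Fin p1) ℝ) (h : Pᵀ * Q = 0)
    (S T : Fin p1 → Fin p2 → Fin p3 → ℝ) : innerT (act1 P S) (act1 Q T) = 0 := by
  unfold innerT
  rw [Finset.sum_comm]
  refine Finset.sum_eq_zero fun j _ => ?_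
  rw [Finset.sum_comm]
  exact Finset.sum_eq_zero fun k _ => vec_orth P Q h (fun x => S x j k) (fun x => T x j k)

theorem orth2 (P Q : Matrix (Fin p2) (Fin p2) ℝ) (h : Pᵀ * Q = 0)
    (S T : Fin p1 → Fin p2 → Fin p3 → ℝ) : innerT (act2 P S) (act2 Q T) = 0 := by
  unfold innerT
  refine Finset.sum_eq_zero fun i _ => ?_
  rw [Finset.sum_comm]
  exact Finset.sum_eq_zero fun k _ => vec_orth P Q h (fun x => S i x k) (fun x => T i x k)

theorem orth3 (P Q : Matrix (Fin p3) (Fin p3) ℝ) (h : Pᵀ * Q = 0)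
    (S T : Fin p1 → Fin p2 → Fin p3 → ℝ) : innerT (act3 P S) (act3 Q T) = 0 := by
  unfold innerT
  exact Finset.sum_eq_zero fun i _ => Finset.sum_eq_zero fun j _ =>
    vec_orth P Q h (fun x => S i j x) (fun x => T i j x)

theorem act1_add (P Q : Matrix (Fin p1) (Fin p1) ℝ) (T : Fin p1 → Fin p2 → Fin p3 → ℝ) :
    act1 (P + Q) T = act1 P T + act1 Q T := by
  funext i j k
  simp [act1, add_mul, Finset.sum_add_distrib]

theorem act2_add (P Q : Matrix (Fin p2) (Fin p2) ℝ) (T : Fin p1 → Fin p2 → Fin p3 → ℝ) :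
    act2 (P + Q) T = act2 P T + act2 Q T := by
  funext i j k
  simp [act2, add_mul, Finset.sum_add_distrib]

theorem act3_add (P Q : Matrix (Fin p3) (Fin p3) ℝ) (T : Fin p1 → Fin p2 → Fin p3 → ℝ) :
    act3 (P + Q) T = act3 P T + act3 Q T := by
  funext i j k
  simp [act3, add_mul, Finset.sum_add_distrib]

theorem act1_add' (P : Matrix (Fin p1) (Fin p1) ℝ) (S T : Fin p1 → Fin p2 → Fin p3 → ℝ) :
    act1 P (S + T) = act1 P S + act1 P T := by
  funext i j k
  simp [act1, mul_add, Finset.sum_add_distrib]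

theorem act2_add' (P : Matrix (Fin p2) (Fin p2) ℝ) (S T : Fin p1 → Fin p2 → Fin p3 → ℝ) :
    act2 P (S + T) = act2 P S + act2 P T := by
  funext i j k
  simp [act2, mul_add, Finset.sum_add_distrib]

end TAR

open TAR in
/-- Splitting of a tensor of Tucker ranks at most (4r1, 4r2, 4r3) into 8 pairwise
orthogonal tensors, each of Tucker ranks at most (2r1, 2r2, 2r3). -/
theorem statement11 {p1 p2 p3 r1 r2 r3 : ℕ}
    (Δ : Fin p1 → Fin p2 → Fin p3 → ℝ)
    (h1 : (unfold1 Δ).rank ≤ 4 * r1) (h2 : (unfold2 Δ).rank ≤ 4 * r2)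
    (h3 : (unfold3 Δ).rank ≤ 4 * r3) :
    ∃ D : Fin 8 → (Fin p1 → Fin p2 → Fin p3 → ℝ),
      (∀ i j k, Δ i j k = ∑ m, D m i j k) ∧
      (∀ m, (unfold1 (D m)).rank ≤ 2 * r1 ∧ (unfold2 (D m)).rank ≤ 2 * r2 ∧
        (unfold3 (D m)).rank ≤ 2 * r3) ∧
      (∀ m m' : Fin 8, m ≠ m' → innerT (D m) (D m') = 0) := by
  obtain ⟨P, hP, hPr, hPo⟩ := TAR.exists_split _ h1
  obtain ⟨Q, hQ, hQr, hQo⟩ := TAR.exists_split _ h2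
  obtain ⟨R, hR, hRr, hRo⟩ := TAR.exists_split _ h3
  have eP : act1 (P 0 + P 1) Δ = Δ := by
    funext i j k; exact congrFun (congrFun hP i) (k, j)
  have eQ : act2 (Q 0 + Q 1) Δ = Δ := by
    funext i j k; exact congrFun (congrFun hQ j) (k, i)
  have eR : act3 (R 0 + R 1) Δ = Δ := by
    funext i j k; exact congrFun (congrFun hR k) (j, i)
  let a : Fin 8 → Fin 2 := ![0, 0, 0, 0, 1, 1, 1, 1]
  let b : Fin 8 → Fin 2 := ![0, 0, 1, 1, 0, 0, 1, 1]
  let c : Fin 8 → Fin 2 := ![0, 1, 0, 1, 0, 1, 0, 1]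
  have hinj : ∀ m m' : Fin 8, m ≠ m' → a m ≠ a m' ∨ b m ≠ b m' ∨ c m ≠ c m' := by decide
  refine ⟨fun m => act1 (P (a m)) (act2 (Q (b m)) (act3 (R (c m)) Δ)), ?_, ?_, ?_⟩
  · have e : Δ = act1 (P 0 + P 1) (act2 (Q 0 + Q 1) (act3 (R 0 + R 1) Δ)) := by
      rw [eR, eQ, eP]
    intro i j k
    have e' := congrFun (congrFun (congrFun e i) j) k
    rw [e']
    simp only [act1_add, act2_add, act3_add, act1_add', act2_add', Pi.add_apply,
      Fin.sum_univ_eight]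
    simp only [a, b, c, Matrix.cons_val]
    ring
  · intro m
    refine ⟨(rank_act1 _ _).trans (hPr _), ?_, ?_⟩
    · simp only [act12]
      exact (rank_act2 _ _).trans (hQr _)
    · simp only [act23, act13]
      exact (rank_act3 _ _).trans (hRr _)
  · intro m m' hm
    rcases hinj m m' hm with h | h | h
    · exact orth1 _ _ (hPo _ _ h) _ _
    · simp only [act12]
      exact orth2 _ _ (hQo _ _ h) _ _
    · simp only [act23, act13]
      exact orth3 _ _ (hRo _ _ h) _ _
end
end

section
/- Let S(2r_1, 2r_2, 2r_3) = {𝒲 ∈ ℝ^{p_1×p_2×p_3} : ‖𝒲‖_F = 1, rank_i(𝒲) ≤ 2r_i for i = 1,2,3}, let 0 < ε < 1/(2√2), and let S̄ be an ε-net of S(2r_1, 2r_2, 2r_3) in the Frobenius norm. Then for any tensor 𝒩 ∈ ℝ^{p_1×p_2×p_3}, sup_{𝒲 ∈ S(2r_1,2r_2,2r_3)} ⟨𝒩, 𝒲⟩ ≤ (1 − 2√2 ε)^{−1} · max_{𝒲̄ ∈ S̄} ⟨𝒩, 𝒲̄⟩. -/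
noncomputable section
open Matrix BigOperators Kronecker

namespace TAR
/-- The class S(s1, s2, s3) of unit-Frobenius-norm tensors with Tucker ranks
at most (s1, s2, s3). -/
def Sclass (p1 p2 p3 s1 s2 s3 : ℕ) : Set (Fin p1 → Fin p2 → Fin p3 → ℝ) :=
  { T | frobT T = 1 ∧ (unfold1 T).rank ≤ s1 ∧ (unfold2 T).rank ≤ s2 ∧
        (unfold3 T).rank ≤ s3 }
end TAR

namespace TAR

lemma exists_U_s12 {p : ℕ} {q : Type*} [Fintype q] [DecidableEq q] (M : Matrix (Fin p) q ℝ) :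
    ∃ (d : ℕ) (U : Matrix (Fin p) (Fin d) ℝ), d = M.rank ∧ Uᵀ * U = 1 ∧ U * (Uᵀ * M) = M := by
  let W : Submodule ℝ (EuclideanSpace ℝ (Fin p)) :=
    Submodule.span ℝ (Set.range fun c : q => WithLp.toLp 2 (M.col c))
  have hd : Module.finrank ℝ W = M.rank := by
    rw [Matrix.rank_eq_finrank_span_cols]
    have : W = (Submodule.span ℝ (Set.range M.col)).map
        (WithLp.linearEquiv 2 ℝ (Fin p → ℝ)).symm.toLinearMap := by
      rw [Submodule.map_span, ← Set.range_comp]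
      rfl
    rw [this]
    exact LinearEquiv.finrank_map_eq _ _
  let b := stdOrthonormalBasis ℝ W
  refine ⟨_, Matrix.of fun i a => (b a : EuclideanSpace ℝ (Fin p)) i, hd, ?_, ?_⟩
  · ext a c
    have h := orthonormal_iff_ite.mp b.orthonormal a c
    rw [Submodule.coe_inner, PiLp.inner_apply] at h
    simp only [Matrix.mul_apply, Matrix.transpose_apply, Matrix.of_apply, Matrix.one_apply]
    rw [← h]
    refine Finset.sum_congr rfl fun i _ => ?_
    simp [mul_comm]
  · ext i c
    let w : W := ⟨WithLp.toLp 2 (M.col c), Submodule.subset_span ⟨c, rfl⟩⟩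
    have h := congrArg (fun x : W => (x : EuclideanSpace ℝ (Fin p)) i) (b.sum_repr' w)
    simp only [Submodule.coe_sum, Submodule.coe_smul, Submodule.coe_inner, PiLp.inner_apply] at h
    simp only [WithLp.ofLp_sum, Finset.sum_apply, PiLp.smul_apply, smul_eq_mul] at h
    simp only [Matrix.mul_apply, Matrix.transpose_apply, Matrix.of_apply]
    have h2 : ((w : EuclideanSpace ℝ (Fin p)) i) = M i c := rfl
    rw [← h2, ← h]
    refine Finset.sum_congr rfl fun a _ => ?_
    rw [mul_comm]
    congr 1
    refine Finset.sum_congr rfl fun i _ => ?_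
    simp [w, mul_comm, Matrix.col]

lemma exists_P {p : ℕ} {q : Type*} [Fintype q] [DecidableEq q] (M : Matrix (Fin p) q ℝ) (s : ℕ)
    (h : M.rank ≤ 2 * s) :
    ∃ P : Matrix (Fin p) (Fin p) ℝ, Pᵀ * P = Pᵀ ∧ (P * M).rank ≤ s ∧
      ((1 - P) * M).rank ≤ s := by
  obtain ⟨d, U, hd, hU, hM⟩ := exists_U_s12 M
  let w : Fin d → ℝ := fun i => if i.1 < s then 1 else 0
  let D : Matrix (Fin d) (Fin d) ℝ := Matrix.diagonal w
  have hDD : D * D = D := by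
    simp only [D, Matrix.diagonal_mul_diagonal]
    congr 1; ext i; simp only [w]; split_ifs <;> simp
  have hDt : Dᵀ = D := Matrix.diagonal_transpose _
  have hr1 : D.rank ≤ s := by
    rw [Matrix.rank_diagonal]
    have : Function.Injective
        (fun i : {i // w i ≠ 0} => (⟨i.1.1, by
          have := i.2
          by_contra hc
          simp [w, hc] at this⟩ : Fin s)) := by
      intro a b hab
      simp only [Fin.mk.injEq] at hab
      exact Subtype.ext (Fin.ext hab)
    simpa using Fintype.card_le_of_injective _ this
  have hr2 : (1 - D).rank ≤ s := by
    have h1 : 1 - D = Matrix.diagonal (fun i => 1 - w i) := by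
      rw [← Matrix.diagonal_one, Matrix.diagonal_sub]
    rw [h1, Matrix.rank_diagonal]
    have hx : ∀ i : {i // 1 - w i ≠ 0}, s ≤ i.1.1 := by
      intro i
      have := i.2
      by_contra hc
      simp [w, not_le.mp hc] at this
    have : Function.Injective
        (fun i : {i // 1 - w i ≠ 0} => (⟨i.1.1 - s, by
          have := hx i
          have := i.1.2
          omega⟩ : Fin s)) := by
      intro a b hab
      simp only [Fin.mk.injEq] at hab
      have := hx a
      have := hx b
      exact Subtype.ext (Fin.ext (by omega))
    simpa using Fintype.card_le_of_injective _ this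
  refine ⟨U * D * Uᵀ, ?_, ?_, ?_⟩
  · simp only [Matrix.transpose_mul, Matrix.transpose_transpose, hDt]
    calc U * (D * Uᵀ) * (U * D * Uᵀ) = U * (D * (Uᵀ * U) * D) * Uᵀ := by
          simp only [Matrix.mul_assoc]
      _ = U * (D * Uᵀ) := by rw [hU, Matrix.mul_one, hDD, Matrix.mul_assoc]
  · calc (U * D * Uᵀ * M).rank ≤ (U * D * Uᵀ).rank := Matrix.rank_mul_le_left _ _
      _ ≤ (U * D).rank := Matrix.rank_mul_le_left _ _
      _ ≤ D.rank := Matrix.rank_mul_le_right _ _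
      _ ≤ s := hr1
  · have : (1 - U * D * Uᵀ) * M = U * (1 - D) * (Uᵀ * M) := by
      rw [Matrix.sub_mul, Matrix.one_mul, Matrix.mul_sub, Matrix.mul_one, Matrix.sub_mul, hM,
        Matrix.mul_assoc (U * D)]
    rw [this]
    calc _ ≤ (U * (1 - D)).rank := Matrix.rank_mul_le_left _ _
      _ ≤ (1 - D).rank := Matrix.rank_mul_le_right _ _
      _ ≤ s := hr2

lemma fiber_sq {p : ℕ} (P : Matrix (Fin p) (Fin p) ℝ) (hP : Pᵀ * P = Pᵀ) (v : Fin p → ℝ) :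
    ∑ i, (∑ a, P i a * v a) ^ 2 + ∑ i, (v i - ∑ a, P i a * v a) ^ 2 = ∑ i, v i ^ 2 := by
  have h : (P *ᵥ v) ⬝ᵥ (P *ᵥ v) = v ⬝ᵥ (P *ᵥ v) := by
    have h1 : (P *ᵥ v) ⬝ᵥ (P *ᵥ v) = v ⬝ᵥ ((Pᵀ * P) *ᵥ v) := by
      rw [← Matrix.mulVec_mulVec, Matrix.dotProduct_mulVec v, Matrix.vecMul_transpose]
    rw [h1, hP, Matrix.dotProduct_mulVec, Matrix.vecMul_transpose, dotProduct_comm]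
  simp only [dotProduct, Matrix.mulVec] at h
  have h3 : ∀ i, (v i - ∑ a, P i a * v a) ^ 2 = v i ^ 2 - 2 * (v i * ∑ a, P i a * v a)
      + (∑ a, P i a * v a) * (∑ a, P i a * v a) := fun i => by ring
  have h4 : ∀ i, (∑ a, P i a * v a) ^ 2 = (∑ a, P i a * v a) * (∑ a, P i a * v a) :=
    fun i => by ring
  simp only [h3, h4, Finset.sum_add_distrib, Finset.sum_sub_distrib, ← Finset.mul_sum]
  linarith

variable {p1 p2 p3 : ℕ}

def sqT (T : Fin p1 → Fin p2 → Fin p3 → ℝ) : ℝ := ∑ i, ∑ j, ∑ k, (T i j k) ^ 2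

lemma rank_of_mul {m n : Type*} [Fintype m] [Fintype n] [DecidableEq n] {A B : Matrix m n ℝ}
    (R : Matrix n n ℝ) (h : A = B * R) : A.rank ≤ B.rank := h ▸ Matrix.rank_mul_le_left _ _

lemma rank_of_mul' {m n : Type*} [Fintype m] [Fintype n] [DecidableEq n] {A B C : Matrix m n ℝ}
    (R : Matrix n n ℝ) (h : A = B * R) (hC : C = B - A) : C.rank ≤ B.rank :=
  rank_of_mul (1 - R) (by rw [hC, h, Matrix.mul_sub, Matrix.mul_one])

lemma split1 (T : Fin p1 → Fin p2 → Fin p3 → ℝ) (s : ℕ) (h : (unfold1 T).rank ≤ 2 * s) :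
    ∃ A B : Fin p1 → Fin p2 → Fin p3 → ℝ, T = A + B ∧ sqT A + sqT B = sqT T ∧
      ((unfold1 A).rank ≤ s ∧ (unfold2 A).rank ≤ (unfold2 T).rank ∧
        (unfold3 A).rank ≤ (unfold3 T).rank) ∧
      ((unfold1 B).rank ≤ s ∧ (unfold2 B).rank ≤ (unfold2 T).rank ∧
        (unfold3 B).rank ≤ (unfold3 T).rank) := by
  obtain ⟨P, hP, h1, h2⟩ := exists_P _ s h
  let A : Fin p1 → Fin p2 → Fin p3 → ℝ := fun i j k => ∑ a, P i a * T a j k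
  have e1 : unfold1 A = P * unfold1 T := by
    ext i ⟨a, b⟩; simp [unfold1, Matrix.mul_apply, A]
  have e2 : unfold2 A = unfold2 T * ((1 : Matrix (Fin p3) (Fin p3) ℝ) ⊗ₖ Pᵀ) := by
    ext i ⟨a, b⟩
    simp [unfold2, Matrix.mul_apply, A, Fintype.sum_prod_type, Matrix.one_apply, mul_comm]
  have e3 : unfold3 A = unfold3 T * ((1 : Matrix (Fin p2) (Fin p2) ℝ) ⊗ₖ Pᵀ) := by
    ext i ⟨a, b⟩
    simp [unfold3, Matrix.mul_apply, A, Fintype.sum_prod_type, Matrix.one_apply, mul_comm]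
  refine ⟨A, T - A, by simp, ?_, ⟨e1 ▸ h1, rank_of_mul _ e2, rank_of_mul _ e3⟩,
    ?_, rank_of_mul' _ e2 rfl, rank_of_mul' _ e3 rfl⟩
  · have hs : ∀ X : Fin p1 → Fin p2 → Fin p3 → ℝ,
        sqT X = ∑ j, ∑ k, ∑ i, X i j k ^ 2 := by
      intro X
      unfold sqT
      rw [Finset.sum_comm]
      exact Finset.sum_congr rfl fun j _ => Finset.sum_comm
    rw [hs, hs, hs]
    simp only [← Finset.sum_add_distrib]
    refine Finset.sum_congr rfl fun j _ => Finset.sum_congr rfl fun k _ => ?_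
    rw [← fiber_sq P hP, ← Finset.sum_add_distrib]
    rfl
  · rw [Matrix.sub_mul, Matrix.one_mul, ← e1] at h2
    exact h2

lemma split2 (T : Fin p1 → Fin p2 → Fin p3 → ℝ) (s : ℕ) (h : (unfold2 T).rank ≤ 2 * s) :
    ∃ A B : Fin p1 → Fin p2 → Fin p3 → ℝ, T = A + B ∧ sqT A + sqT B = sqT T ∧
      ((unfold1 A).rank ≤ (unfold1 T).rank ∧ (unfold2 A).rank ≤ s ∧
        (unfold3 A).rank ≤ (unfold3 T).rank) ∧
      ((unfold1 B).rank ≤ (unfold1 T).rank ∧ (unfold2 B).rank ≤ s ∧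
        (unfold3 B).rank ≤ (unfold3 T).rank) := by
  obtain ⟨P, hP, h1, h2⟩ := exists_P _ s h
  let A : Fin p1 → Fin p2 → Fin p3 → ℝ := fun i j k => ∑ a, P j a * T i a k
  have e2 : unfold2 A = P * unfold2 T := by
    ext i ⟨a, b⟩; simp [unfold2, Matrix.mul_apply, A]
  have e1 : unfold1 A = unfold1 T * ((1 : Matrix (Fin p3) (Fin p3) ℝ) ⊗ₖ Pᵀ) := by
    ext i ⟨a, b⟩
    simp [unfold1, Matrix.mul_apply, A, Fintype.sum_prod_type, Matrix.one_apply, mul_comm]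
  have e3 : unfold3 A = unfold3 T * (Pᵀ ⊗ₖ (1 : Matrix (Fin p1) (Fin p1) ℝ)) := by
    ext i ⟨a, b⟩
    simp [unfold3, Matrix.mul_apply, A, Fintype.sum_prod_type, Matrix.one_apply, mul_comm]
  refine ⟨A, T - A, by simp, ?_, ⟨rank_of_mul _ e1, e2 ▸ h1, rank_of_mul _ e3⟩,
    rank_of_mul' _ e1 rfl, ?_, rank_of_mul' _ e3 rfl⟩
  · have hs : ∀ X : Fin p1 → Fin p2 → Fin p3 → ℝ,
        sqT X = ∑ i, ∑ k, ∑ j, X i j k ^ 2 := by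
      intro X
      unfold sqT
      exact Finset.sum_congr rfl fun j _ => Finset.sum_comm
    rw [hs, hs, hs]
    simp only [← Finset.sum_add_distrib]
    refine Finset.sum_congr rfl fun j _ => Finset.sum_congr rfl fun k _ => ?_
    rw [← fiber_sq P hP, ← Finset.sum_add_distrib]
    rfl
  · rw [Matrix.sub_mul, Matrix.one_mul, ← e2] at h2
    exact h2

lemma split3 (T : Fin p1 → Fin p2 → Fin p3 → ℝ) (s : ℕ) (h : (unfold3 T).rank ≤ 2 * s) :
    ∃ A B : Fin p1 → Fin p2 → Fin p3 → ℝ, T = A + B ∧ sqT A + sqT B = sqT T ∧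
      ((unfold1 A).rank ≤ (unfold1 T).rank ∧ (unfold2 A).rank ≤ (unfold2 T).rank ∧
        (unfold3 A).rank ≤ s) ∧
      ((unfold1 B).rank ≤ (unfold1 T).rank ∧ (unfold2 B).rank ≤ (unfold2 T).rank ∧
        (unfold3 B).rank ≤ s) := by
  obtain ⟨P, hP, h1, h2⟩ := exists_P _ s h
  let A : Fin p1 → Fin p2 → Fin p3 → ℝ := fun i j k => ∑ a, P k a * T i j a
  have e3 : unfold3 A = P * unfold3 T := by
    ext i ⟨a, b⟩; simp [unfold3, Matrix.mul_apply, A]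
  have e1 : unfold1 A = unfold1 T * (Pᵀ ⊗ₖ (1 : Matrix (Fin p2) (Fin p2) ℝ)) := by
    ext i ⟨a, b⟩
    simp [unfold1, Matrix.mul_apply, A, Fintype.sum_prod_type, Matrix.one_apply, mul_comm]
  have e2 : unfold2 A = unfold2 T * (Pᵀ ⊗ₖ (1 : Matrix (Fin p1) (Fin p1) ℝ)) := by
    ext i ⟨a, b⟩
    simp [unfold2, Matrix.mul_apply, A, Fintype.sum_prod_type, Matrix.one_apply, mul_comm]
  refine ⟨A, T - A, by simp, ?_, ⟨rank_of_mul _ e1, rank_of_mul _ e2, e3 ▸ h1⟩,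
    rank_of_mul' _ e1 rfl, rank_of_mul' _ e2 rfl, ?_⟩
  · unfold sqT
    simp only [← Finset.sum_add_distrib]
    refine Finset.sum_congr rfl fun j _ => Finset.sum_congr rfl fun k _ => ?_
    rw [← fiber_sq P hP, ← Finset.sum_add_distrib]
    rfl
  · rw [Matrix.sub_mul, Matrix.one_mul, ← e3] at h2
    exact h2

lemma sqT_nonneg (T : Fin p1 → Fin p2 → Fin p3 → ℝ) : 0 ≤ sqT T := by
  unfold sqT; positivity

lemma combine (N T A B : Fin p1 → Fin p2 → Fin p3 → ℝ) (c : ℝ) (hc : 0 ≤ c)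
    (hT : T = A + B) (hsq : sqT A + sqT B = sqT T)
    (hA : innerT N A ≤ c * frobT A) (hB : innerT N B ≤ c * frobT B) :
    innerT N T ≤ (c * √2) * frobT T := by
  have h1 : innerT N T = innerT N A + innerT N B := by
    simp [hT, innerT, mul_add, Finset.sum_add_distrib]
  have h2 : frobT A + frobT B ≤ √2 * frobT T := by
    change √(sqT A) + √(sqT B) ≤ √2 * √(sqT T)
    rw [← Real.sqrt_mul (by norm_num), ← hsq]
    apply Real.le_sqrt_of_sq_le
    nlinarith [Real.sq_sqrt (sqT_nonneg A), Real.sq_sqrt (sqT_nonneg B),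
      sq_nonneg (√(sqT A) - √(sqT B))]
  rw [h1]
  nlinarith [mul_le_mul_of_nonneg_left h2 hc]

lemma big (N : Fin p1 → Fin p2 → Fin p3 → ℝ) (c : ℝ) (hc : 0 ≤ c) (s1 s2 s3 : ℕ)
    (h0 : ∀ T : Fin p1 → Fin p2 → Fin p3 → ℝ, (unfold1 T).rank ≤ s1 → (unfold2 T).rank ≤ s2 →
      (unfold3 T).rank ≤ s3 → innerT N T ≤ c * frobT T)
    (T : Fin p1 → Fin p2 → Fin p3 → ℝ) (h1 : (unfold1 T).rank ≤ 2 * s1)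
    (h2 : (unfold2 T).rank ≤ 2 * s2) (h3 : (unfold3 T).rank ≤ 2 * s3) :
    innerT N T ≤ (c * √2 * √2 * √2) * frobT T := by
  have k1 : ∀ T : Fin p1 → Fin p2 → Fin p3 → ℝ, (unfold1 T).rank ≤ 2 * s1 →
      (unfold2 T).rank ≤ s2 → (unfold3 T).rank ≤ s3 → innerT N T ≤ (c * √2) * frobT T := by
    intro T h1 h2 h3
    obtain ⟨A, B, e, hs, ⟨a1, a2, a3⟩, b1, b2, b3⟩ := split1 T s1 h1
    exact combine N T A B _ (by positivity) e hs (h0 A a1 (a2.trans h2) (a3.trans h3))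
      (h0 B b1 (b2.trans h2) (b3.trans h3))
  have k2 : ∀ T : Fin p1 → Fin p2 → Fin p3 → ℝ, (unfold1 T).rank ≤ 2 * s1 →
      (unfold2 T).rank ≤ 2 * s2 → (unfold3 T).rank ≤ s3 →
      innerT N T ≤ (c * √2 * √2) * frobT T := by
    intro T h1 h2 h3
    obtain ⟨A, B, e, hs, ⟨a1, a2, a3⟩, b1, b2, b3⟩ := split2 T s2 h2
    exact combine N T A B _ (by positivity) e hs (k1 A (a1.trans h1) a2 (a3.trans h3))
      (k1 B (b1.trans h1) b2 (b3.trans h3))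
  obtain ⟨A, B, e, hs, ⟨a1, a2, a3⟩, b1, b2, b3⟩ := split3 T s3 h3
  exact combine N T A B _ (by positivity) e hs (k2 A (a1.trans h1) (a2.trans h2) a3)
      (k2 B (b1.trans h1) (b2.trans h2) b3)

lemma rank_smul_le' {m n : Type*} [Fintype m] [Fintype n] [DecidableEq n] (c : ℝ)
    (A : Matrix m n ℝ) : (c • A).rank ≤ A.rank :=
  rank_of_mul (c • (1 : Matrix n n ℝ)) (by simp)

lemma rank_sub_le' {m n : Type*} [Fintype m] [Fintype n] [DecidableEq n]
    {A B : Matrix m n ℝ} {s : ℕ} (hA : A.rank ≤ s) (hB : B.rank ≤ s) :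
    (A - B).rank ≤ 2 * s := by
  have h1 : A - B = A + (-1 : ℝ) • B := by simp [sub_eq_add_neg]
  have h2 : (A + (-1 : ℝ) • B).rank ≤ A.rank + ((-1 : ℝ) • B).rank := by
    unfold Matrix.rank
    refine le_trans (Submodule.finrank_mono ?_)
      (Submodule.finrank_add_le_finrank_add_finrank _ _)
    rintro _ ⟨v, rfl⟩
    rw [Matrix.mulVecLin_add]
    exact Submodule.add_mem_sup ⟨v, rfl⟩ ⟨v, rfl⟩
  have h3 := rank_smul_le' (-1) B
  rw [h1]; omega

lemma frobT_smul (c : ℝ) (T : Fin p1 → Fin p2 → Fin p3 → ℝ) :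
    frobT (c • T) = |c| * frobT T := by
  unfold frobT
  rw [← Real.sqrt_sq_eq_abs, ← Real.sqrt_mul (sq_nonneg c)]
  simp [mul_pow, Finset.mul_sum]

lemma innerT_smul (c : ℝ) (N T : Fin p1 → Fin p2 → Fin p3 → ℝ) :
    innerT N (c • T) = c * innerT N T := by
  simp only [innerT, Finset.mul_sum, Pi.smul_apply, smul_eq_mul]
  refine Finset.sum_congr rfl fun i _ => Finset.sum_congr rfl fun j _ =>
    Finset.sum_congr rfl fun k _ => by ring

lemma Sclass_smul {s1 s2 s3 : ℕ} (c : ℝ) (T : Fin p1 → Fin p2 → Fin p3 → ℝ)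
    (hc : |c| * frobT T = 1) (h1 : (unfold1 T).rank ≤ s1) (h2 : (unfold2 T).rank ≤ s2)
    (h3 : (unfold3 T).rank ≤ s3) : c • T ∈ Sclass p1 p2 p3 s1 s2 s3 :=
  ⟨by rw [frobT_smul, hc], (rank_smul_le' c (unfold1 T)).trans h1,
    (rank_smul_le' c (unfold2 T)).trans h2, (rank_smul_le' c (unfold3 T)).trans h3⟩

lemma innerT_zero_of (N T : Fin p1 → Fin p2 → Fin p3 → ℝ) (h : frobT T = 0) :
    innerT N T = 0 := by
  have h0 : sqT T = 0 := (Real.sqrt_eq_zero (sqT_nonneg T)).mp h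
  have : ∀ i j k, T i j k = 0 := by
    intro i j k
    unfold sqT at h0
    rw [Finset.sum_eq_zero_iff_of_nonneg (fun _ _ => by positivity)] at h0
    have h1 := h0 i (Finset.mem_univ _)
    rw [Finset.sum_eq_zero_iff_of_nonneg (fun _ _ => by positivity)] at h1
    have h2 := h1 j (Finset.mem_univ _)
    rw [Finset.sum_eq_zero_iff_of_nonneg (fun _ _ => by positivity)] at h2
    exact pow_eq_zero_iff (two_ne_zero) |>.mp (h2 k (Finset.mem_univ _))
  simp [innerT, this]

lemma innerT_le (N T : Fin p1 → Fin p2 → Fin p3 → ℝ) (h : frobT T = 1) :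
    innerT N T ≤ sqT N + 1 := by
  have h0 : sqT T = 1 := Real.sqrt_eq_one.mp h
  rw [← h0]
  unfold innerT sqT
  simp only [← Finset.sum_add_distrib]
  refine Finset.sum_le_sum fun i _ => Finset.sum_le_sum fun j _ =>
    Finset.sum_le_sum fun k _ => ?_
  nlinarith [sq_nonneg (N i j k - T i j k), sq_nonneg (N i j k), sq_nonneg (T i j k)]

end TAR

open TAR in
/-- Discretization step in the proof of Theorem 1: the supremum of ⟨𝒩, ·⟩ over
S(2r1,2r2,2r3) is controlled by its maximum over an ε-net S̄ ⊆ S(2r1,2r2,2r3). -/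
theorem statement12 {p1 p2 p3 r1 r2 r3 : ℕ} (ε : ℝ) (hε : 0 < ε)
    (hε' : ε < 1 / (2 * Real.sqrt 2))
    (Sbar : Finset (Fin p1 → Fin p2 → Fin p3 → ℝ))
    (hsub : ∀ Tb ∈ Sbar, Tb ∈ Sclass p1 p2 p3 (2 * r1) (2 * r2) (2 * r3))
    (hnet : ∀ T ∈ Sclass p1 p2 p3 (2 * r1) (2 * r2) (2 * r3),
      ∃ Tb ∈ Sbar, frobT (fun i j k => T i j k - Tb i j k) ≤ ε)
    (𝒩 : Fin p1 → Fin p2 → Fin p3 → ℝ) :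
    sSup {x | ∃ T ∈ Sclass p1 p2 p3 (2 * r1) (2 * r2) (2 * r3), x = innerT 𝒩 T} ≤
      (1 - 2 * Real.sqrt 2 * ε)⁻¹ *
        sSup {x | ∃ Tb ∈ Sbar, x = innerT 𝒩 Tb} := by
  set S := Sclass p1 p2 p3 (2 * r1) (2 * r2) (2 * r3) with hS
  set X := {x | ∃ T ∈ S, x = innerT 𝒩 T} with hX
  have hXb : BddAbove X := ⟨sqT 𝒩 + 1, by
    rintro x ⟨T, hT, rfl⟩
    exact innerT_le 𝒩 T hT.1⟩
  set Y := {x | ∃ Tb ∈ Sbar, x = innerT 𝒩 Tb} with hY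
  have hYb : BddAbove Y := hXb.mono (by
    rintro x ⟨T, hT, rfl⟩
    exact ⟨T, hsub T hT, rfl⟩)
  rcases X.eq_empty_or_nonempty with hXe | hXne
  · have hYe : Y = ∅ := by
      rw [Set.eq_empty_iff_forall_notMem] at hXe ⊢
      rintro x ⟨T, hT, rfl⟩
      exact hXe _ ⟨T, hsub T hT, rfl⟩
    rw [hXe, hYe]; simp
  have hle : ∀ T ∈ S, innerT 𝒩 T ≤ sSup X := fun T hT => le_csSup hXb ⟨T, hT, rfl⟩
  have hc : 0 ≤ sSup X := by
    obtain ⟨x, T, hT, rfl⟩ := hXne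
    have h1 := hle T hT
    have h2 := hle ((-1 : ℝ) • T) (Sclass_smul (-1) T (by simp [hT.1]) hT.2.1 hT.2.2.1 hT.2.2.2)
    rw [innerT_smul] at h2
    linarith
  have h0 : ∀ T : Fin p1 → Fin p2 → Fin p3 → ℝ, (unfold1 T).rank ≤ 2 * r1 →
      (unfold2 T).rank ≤ 2 * r2 → (unfold3 T).rank ≤ 2 * r3 →
      innerT 𝒩 T ≤ sSup X * frobT T := by
    intro T h1 h2 h3
    have hn : 0 ≤ frobT T := Real.sqrt_nonneg _
    rcases hn.eq_or_lt with hz | hpos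
    · rw [innerT_zero_of 𝒩 T hz.symm, ← hz]; simp
    · have h := hle ((frobT T)⁻¹ • T) (Sclass_smul _ T (by
        rw [abs_of_pos (inv_pos.mpr hpos), inv_mul_cancel₀ hpos.ne']) h1 h2 h3)
      rw [innerT_smul, inv_mul_le_iff₀ hpos] at h
      linarith
  have hs2 : √2 * √2 = (2 : ℝ) := Real.mul_self_sqrt (by norm_num)
  have hpos : 0 < 1 - 2 * √2 * ε := by
    rw [lt_div_iff₀ (by positivity)] at hε'
    linarith
  rw [le_inv_mul_iff₀ hpos]
  have key : sSup X ≤ sSup Y + sSup X * (2 * √2) * ε := by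
    apply csSup_le hXne
    rintro x ⟨T, hT, rfl⟩
    obtain ⟨Tb, hTb, hd⟩ := hnet T hT
    have hTb' := hsub Tb hTb
    have hb := big 𝒩 (sSup X) hc _ _ _ h0 (fun i j k => T i j k - Tb i j k)
      (rank_sub_le' hT.2.1 hTb'.2.1) (rank_sub_le' hT.2.2.1 hTb'.2.2.1)
      (rank_sub_le' hT.2.2.2 hTb'.2.2.2)
    have hy : innerT 𝒩 Tb ≤ sSup Y := le_csSup hYb ⟨Tb, hTb, rfl⟩
    have hsplit : innerT 𝒩 (fun i j k => T i j k - Tb i j k) = innerT 𝒩 T - innerT 𝒩 Tb := by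
      simp [innerT, mul_sub, Finset.sum_sub_distrib]
    have he : sSup X * √2 * √2 * √2 = sSup X * (2 * √2) := by
      linear_combination sSup X * √2 * hs2
    rw [hsplit, he] at hb
    have := mul_le_mul_of_nonneg_left hd (show 0 ≤ sSup X * (2 * √2) by positivity)
    linarith
  linarith
end
end
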